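/- Let c = inf(supp μ) ∈ ℝ and assume all masses M_0, …, M_r are strictly positive. Suppose there are sequences a_n, b_n > 0 with a_n^{−1/2}/(A n^a) → 1 and b_n/(B n^b) → 1 for some constants A, B, b > 0 and a ∈ ℝ, a real number ν > −1 with 2a+1 = b(ν+1), and suppose that for every j = 0,1,…,r+1, uniformly on compact subsets of ℂ, (−1)^n (a_n^{1/2}/b_n^j) · p_n^{[2j]}(c + z²/b_n) → φ_{ν+2j}(z) as n → ∞. Then, uniformly on compact subsets of ℂ, (−1)^n a_n^{1/2} q_n(c + z²/b_n) → (−1)^{r+1} z^{2r+2} φ_{ν+2r+2}(z) (that is, to (−1)^{r+1} z^{−ν} J_{ν+2r+2}(2z)). -/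

import Mathlib

open MeasureTheory Polynomial Filter Topology

noncomputable section

/-- The support of a Borel measure on `ℝ`. -/
def measSupport (μ : Measure ℝ) : Set ℝ := {x | ∀ U ∈ nhds x, μ U ≠ 0}

/-- `P` is a sequence of orthonormal polynomials with respect to the measure `μ`. -/
def IsOPS (μ : Measure ℝ) (P : ℕ → Polynomial ℝ) : Prop :=
  (∀ n, (P n).degree = n) ∧ (∀ n, 0 < (P n).leadingCoeff) ∧
    ∀ n m, (∫ x, (P n).eval x * (P m).eval x ∂μ) = if n = m then 1 else 0

/-- The modified measure `dμ_j(x) = (x-c)^j dμ(x)`. -/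
def muMod (μ : Measure ℝ) (c : ℝ) (j : ℕ) : Measure ℝ :=
  μ.withDensity fun x => ENNReal.ofReal ((x - c) ^ j)

/-- The discrete Sobolev inner product. -/
def sobInner (μ : Measure ℝ) (c : ℝ) (r : ℕ) (M : ℕ → ℝ) (p q : Polynomial ℝ) : ℝ :=
  (∫ x, p.eval x * q.eval x ∂μ) +
    ∑ i ∈ Finset.range (r + 1),
      M i * (Polynomial.derivative^[i] p).eval c * (Polynomial.derivative^[i] q).eval c

/-- `Q` is the sequence of orthonormal polynomials for the Sobolev inner product. -/
def IsSobOPS (μ : Measure ℝ) (c : ℝ) (r : ℕ) (M : ℕ → ℝ) (Q : ℕ → Polynomial ℝ) : Prop :=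
  (∀ n, (Q n).degree = n) ∧ (∀ n, 0 < (Q n).leadingCoeff) ∧
    ∀ n m, sobInner μ c r M (Q n) (Q m) = if n = m then 1 else 0

/-- `φ_ν(z) = Σ_{k≥0} (-1)^k z^{2k} / (k! Γ(k+ν+1)) = z^{-ν} J_ν(2z)`. -/
def phi (ν : ℝ) (z : ℂ) : ℂ :=
  ∑' k : ℕ, ((-1 : ℂ) ^ k * z ^ (2 * k)) /
    ((k.factorial : ℂ) * Complex.Gamma ((k : ℂ) + (ν : ℂ) + 1))

/-- Cauchy's estimate for the coefficients of an entire power series. -/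
theorem norm_coeff_le_of_norm_tsum_le {c : ℕ → ℂ} (hs : ∀ z : ℂ, Summable fun m => c m * z ^ m)
    {R C : ℝ} (hR : 0 < R) (hC : ∀ z : ℂ, ‖z‖ = R → ‖∑' m, c m * z ^ m‖ ≤ C) (m : ℕ) :
    ‖c m‖ ≤ C / R ^ m := by
  set f : ℂ → ℂ := fun z => ∑' m, c m * z ^ m with hf
  have hrad : (FormalMultilinearSeries.ofScalars ℂ c).radius = ⊤ := by
    refine FormalMultilinearSeries.radius_eq_top_of_summable_norm _ fun t => ?_
    refine (hs (t : ℝ)).norm.congr fun n => ?_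
    simp
  have hps : HasFPowerSeriesOnBall f (FormalMultilinearSeries.ofScalars ℂ c) 0 ⊤ := by
    refine ⟨hrad.ge, by simp, fun {y} _ => ?_⟩
    simpa [FormalMultilinearSeries.ofScalars_apply_eq, hf, smul_eq_mul, mul_comm] using (hs y).hasSum
  have hd : Differentiable ℂ f := fun z =>
    (hps.analyticOnNhd z (by simp)).differentiableAt
  lift R to NNReal using hR.le
  have hR' : 0 < R := by exact_mod_cast hR
  have h2 := (hd.diffContOnCl (s := Metric.ball 0 R)).hasFPowerSeriesOnBall hR'
  have h3 : FormalMultilinearSeries.ofScalars ℂ c = cauchyPowerSeries f 0 R :=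
    hps.hasFPowerSeriesAt.eq_formalMultilinearSeries h2.hasFPowerSeriesAt
  have h4 := norm_cauchyPowerSeries_le f 0 R m
  rw [← h3, FormalMultilinearSeries.ofScalars_norm] at h4
  refine h4.trans ?_
  have h5 : (∫ θ : ℝ in (0 : ℝ)..2 * Real.pi, ‖f (circleMap 0 R θ)‖) ≤ 2 * Real.pi * C := by
    have : (∫ θ : ℝ in (0 : ℝ)..2 * Real.pi, ‖f (circleMap 0 R θ)‖) ≤
        ∫ θ : ℝ in (0 : ℝ)..2 * Real.pi, C := by
      refine intervalIntegral.integral_mono_on Real.two_pi_pos.le ?_ (by simp) fun θ _ => ?_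
      · exact ((hd.continuous.comp (continuous_circleMap 0 R)).norm).intervalIntegrable _ _
      · exact hC _ (by simp)
    simpa using this
  have h6 : (2 * Real.pi)⁻¹ * (∫ θ : ℝ in (0 : ℝ)..2 * Real.pi, ‖f (circleMap 0 R θ)‖) ≤ C := by
    rw [inv_mul_le_iff₀ Real.two_pi_pos]; exact h5
  rw [div_eq_mul_inv, ← inv_pow, abs_of_pos hR]
  gcongr

/-- Convergence of the coefficients of power series, together with super-exponential bounds, gives
uniform convergence on bounded sets. -/
theorem tendstoUniformlyOn_tsum_of_tendsto_coeff {c : ℕ → ℕ → ℂ} {f : ℕ → ℂ}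
    (hlim : ∀ m, Tendsto (fun n => c n m) atTop (𝓝 (f m)))
    (hbd : ∀ R > 0, ∃ C, ∀ᶠ n in atTop, ∀ m, ‖c n m‖ ≤ C / R ^ m) (ρ : ℝ) :
    TendstoUniformlyOn (fun n w => ∑' m, c n m * w ^ m) (fun w => ∑' m, f m * w ^ m) atTop
      (Metric.closedBall 0 ρ) := by
  set s : ℝ := max ρ 1
  have hs : 0 < s := lt_of_lt_of_le one_pos (le_max_right _ _)
  obtain ⟨C, hC⟩ := hbd (2 * s) (by positivity)
  have hf : ∀ m, ‖f m‖ ≤ C / (2 * s) ^ m := fun m =>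
    le_of_tendsto (hlim m).norm (hC.mono fun n h => h m)
  have hgeo : Summable fun m : ℕ => 2 * C * (1 / 2 : ℝ) ^ m :=
    (summable_geometric_of_lt_one (by norm_num) (by norm_num)).mul_left _
  have key : ∀ x : ℂ, ∀ m : ℕ, ‖x‖ ≤ C / (2 * s) ^ m → ‖x‖ * s ^ m ≤ C * (1 / 2) ^ m := by
    intro x m h
    rw [le_div_iff₀ (by positivity), mul_pow] at h
    rw [one_div, inv_pow, ← div_eq_mul_inv, le_div_iff₀ (by positivity)]
    linarith
  have hD : Tendsto (fun n => ∑' m, ‖c n m - f m‖ * s ^ m) atTop (𝓝 (∑' _ : ℕ, (0 : ℝ))) := by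
    refine tendsto_tsum_of_dominated_convergence hgeo (fun m => ?_) ?_
    · simpa using (((hlim m).sub_const (f m)).norm).mul_const (s ^ m)
    · filter_upwards [hC] with n hn m
      rw [Real.norm_of_nonneg (by positivity)]
      have h1 := key _ _ (hn m)
      have h2 := key _ _ (hf m)
      have h3 : ‖c n m - f m‖ * s ^ m ≤ (‖c n m‖ + ‖f m‖) * s ^ m := by
        gcongr; exact norm_sub_le _ _
      linarith
  rw [tsum_zero] at hD
  have hsm : ∀ x : ℕ → ℂ, (∀ m, ‖x m‖ ≤ C / (2 * s) ^ m) → ∀ w : ℂ, ‖w‖ ≤ s →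
      Summable fun m => ‖x m‖ * s ^ m := by
    intro x hx w hw
    refine Summable.of_nonneg_of_le (fun m => by positivity) (fun m => key _ _ (hx m)) ?_
    exact (summable_geometric_of_lt_one (by norm_num) (by norm_num)).mul_left _
  have hsm' : ∀ x : ℕ → ℂ, (∀ m, ‖x m‖ ≤ C / (2 * s) ^ m) → ∀ w : ℂ, ‖w‖ ≤ s →
      Summable fun m => x m * w ^ m := by
    intro x hx w hw
    refine Summable.of_norm_bounded (hsm x hx w hw) fun m => ?_
    rw [norm_mul, norm_pow]; gcongr
  rw [Metric.tendstoUniformlyOn_iff]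
  intro ε hε
  filter_upwards [hD.eventually (gt_mem_nhds hε), hC] with n hn hCn w hw
  have hw' : ‖w‖ ≤ s := by
    have : ‖w‖ ≤ ρ := by simpa using hw
    exact this.trans (le_max_left _ _)
  rw [dist_comm, dist_eq_norm, ← (hsm' _ hCn w hw').tsum_sub (hsm' _ hf w hw')]
  refine lt_of_le_of_lt ?_ hn
  have hS : Summable fun m => ‖c n m - f m‖ * s ^ m := by
    refine Summable.of_nonneg_of_le (fun m => by positivity) (fun m => ?_)
      ((hsm _ hCn w hw').add (hsm _ hf w hw'))
    rw [← add_mul]; gcongr; exact norm_sub_le _ _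
  refine tsum_of_norm_bounded hS.hasSum fun m => ?_
  rw [← sub_mul, norm_mul, norm_pow]; gcongr

/-- Locally uniform convergence of entire power series in `z ^ 2` gives convergence of the
coefficients, with uniform bounds. -/
theorem coeff_of_tendstoUniformlyOn_sq {c : ℕ → ℕ → ℂ} {f : ℕ → ℂ}
    (hcs : ∀ n (z : ℂ), Summable fun m => c n m * z ^ m)
    (hfs : ∀ z : ℂ, Summable fun m => f m * z ^ m)
    (hu : ∀ K : Set ℂ, IsCompact K → TendstoUniformlyOn
      (fun n z => ∑' m, c n m * (z ^ 2) ^ m) (fun z => ∑' m, f m * (z ^ 2) ^ m) atTop K) :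
    (∀ m, Tendsto (fun n => c n m) atTop (𝓝 (f m))) ∧
      ∀ R > 0, ∃ C, ∀ n m, ‖c n m‖ ≤ C / R ^ m := by
  have main : ∀ R > 0, ∀ ε > 0, ∀ᶠ n in atTop, ∀ m, ‖c n m - f m‖ ≤ ε / R ^ m := by
    intro R hR ε hε
    have h := Metric.tendstoUniformlyOn_iff.1 (hu _ (isCompact_closedBall 0 (√R))) ε hε
    filter_upwards [h] with n hn m
    have hdiff : ∀ z : ℂ, Summable fun m => (c n m - f m) * z ^ m := fun z => by
      simpa [sub_mul] using (hcs n z).sub (hfs z)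
    refine norm_coeff_le_of_norm_tsum_le hdiff hR (fun t ht => ?_) m
    obtain ⟨z, rfl⟩ := IsAlgClosed.exists_pow_nat_eq t (n := 2) (by norm_num)
    have hz : ‖z‖ ≤ √R := by
      rw [norm_pow] at ht
      exact Real.le_sqrt_of_sq_le ht.le
    have := (hn z (by simpa using hz)).le
    rw [dist_comm, dist_eq_norm, ← (hcs n _).tsum_sub (hfs _)] at this
    simpa [sub_mul] using this
  refine ⟨fun m => ?_, fun R hR => ?_⟩
  · rw [Metric.tendsto_nhds]
    intro ε hε
    filter_upwards [main 1 one_pos (ε / 2) (by positivity)] with n hn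
    have := hn m
    rw [dist_eq_norm]
    simp at this
    linarith
  · have hone : ∀ x : ℕ → ℂ, (∀ z : ℂ, Summable fun m => x m * z ^ m) →
        ∃ C, ∀ m, ‖x m‖ ≤ C / R ^ m := by
      intro x hx
      obtain ⟨C, hC⟩ := (hx R).norm.tendsto_atTop_zero.bddAbove_range
      refine ⟨C, fun m => ?_⟩
      have := hC ⟨m, rfl⟩
      rw [le_div_iff₀ (by positivity)]
      simpa [abs_of_pos hR] using this
    choose D hD using fun n => hone (c n) (hcs n)
    obtain ⟨F, hF⟩ := hone f hfs
    obtain ⟨N, hN⟩ := eventually_atTop.1 (main R hR 1 one_pos)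
    refine ⟨(∑ n ∈ Finset.range N, |D n|) + |1 + F|, fun n m => ?_⟩
    have hp : 0 < R ^ m := by positivity
    rcases lt_or_ge n N with h | h
    · refine (hD n m).trans ?_
      gcongr
      have := Finset.single_le_sum (f := fun n => |D n|) (fun i _ => abs_nonneg _)
        (Finset.mem_range.2 h)
      have h2 := le_abs_self (D n)
      have h3 := abs_nonneg (1 + F)
      linarith
    · have h1 : ‖c n m‖ ≤ ‖c n m - f m‖ + ‖f m‖ := by
        simpa using norm_add_le (c n m - f m) (f m)
      have h2 := hN n h m
      have h3 := hF m
      have h4 : (1 + F) / R ^ m ≤ ((∑ n ∈ Finset.range N, |D n|) + |1 + F|) / R ^ m := by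
        refine div_le_div_of_nonneg_right ?_ hp.le
        have := Finset.sum_nonneg (s := Finset.range N) (f := fun n => |D n|)
          (fun i _ => abs_nonneg _)
        linarith [le_abs_self (1 + F)]
      rw [add_div 1 F] at h4
      linarith

theorem tendsto_add_one_rpow_sub_rpow_div {γ : ℝ} :
    Tendsto (fun k : ℕ => (((k : ℝ) + 1) ^ γ - (k : ℝ) ^ γ) / (k : ℝ) ^ (γ - 1)) atTop (𝓝 γ) := by
  have hd : HasDerivAt (fun x : ℝ => x ^ γ) γ 1 := by
    simpa using Real.hasDerivAt_rpow_const (x := 1) (p := γ) (Or.inl one_ne_zero)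
  have h0 : Tendsto (fun k : ℕ => ((k : ℝ))⁻¹) atTop (𝓝[≠] 0) := by
    refine tendsto_nhdsWithin_iff.2 ⟨tendsto_inv_atTop_nhds_zero_nat, ?_⟩
    filter_upwards [eventually_gt_atTop 0] with k hk
    have : (0 : ℝ) < k := by exact_mod_cast hk
    simp [this.ne']
  refine (hd.tendsto_slope_zero.comp h0).congr' ?_
  filter_upwards [eventually_gt_atTop 0] with k hk
  have hk' : (0 : ℝ) < k := by exact_mod_cast hk
  have e1 : (1 + (k : ℝ)⁻¹) = ((k : ℝ) + 1) / k := by field_simp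
  simp only [Function.comp, smul_eq_mul, inv_inv, Real.one_rpow]
  rw [e1, Real.div_rpow (by positivity) hk'.le, Real.rpow_sub_one hk'.ne']
  have : 0 < (k : ℝ) ^ γ := by positivity
  field_simp

/-- Stolz–Cesàro for sequences comparable to a power. -/
theorem tendsto_sum_range_div_rpow {β L : ℝ} (hβ : 0 < β + 1) {x : ℕ → ℝ}
    (hx : Tendsto (fun k : ℕ => x k / (k : ℝ) ^ β) atTop (𝓝 L)) :
    Tendsto (fun n : ℕ => (∑ k ∈ Finset.range n, x k) / (n : ℝ) ^ (β + 1)) atTop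
      (𝓝 (L / (β + 1))) := by
  set γ := β + 1 with hγ
  set g : ℕ → ℝ := fun k => ((k : ℝ) + 1) ^ γ - (k : ℝ) ^ γ with hg
  have hsum : ∀ n, ∑ k ∈ Finset.range n, g k = (n : ℝ) ^ γ := by
    intro n
    have := Finset.sum_range_sub (fun k : ℕ => (k : ℝ) ^ γ) n
    simpa [hg, Real.zero_rpow hβ.ne'] using this
  have hgpos : ∀ k, 0 < g k := fun k =>
    sub_pos.2 (Real.rpow_lt_rpow (by positivity) (by linarith) hβ)
  have hgl : Tendsto (fun k : ℕ => g k / (k : ℝ) ^ β) atTop (𝓝 γ) := by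
    simpa [hγ] using tendsto_add_one_rpow_sub_rpow_div (γ := γ)
  have hratio : Tendsto (fun k => x k / g k) atTop (𝓝 (L / γ)) := by
    refine (hx.div hgl hβ.ne').congr' ?_
    filter_upwards [eventually_gt_atTop 0] with k hk
    have hk' : (0 : ℝ) < k := by exact_mod_cast hk
    have : 0 < (k : ℝ) ^ β := by positivity
    simp only [Pi.div_apply]
    field_simp
  have ho : (fun k => x k - L / γ * g k) =o[atTop] g := by
    rw [Asymptotics.isLittleO_iff_tendsto' (Eventually.of_forall fun k h => absurd h (hgpos k).ne')]
    have := hratio.sub_const (L / γ)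
    rw [sub_self] at this
    refine this.congr fun k => ?_
    have := (hgpos k).ne'
    field_simp
  have htop : Tendsto (fun n : ℕ => (n : ℝ) ^ γ) atTop atTop :=
    (tendsto_rpow_atTop hβ).comp tendsto_natCast_atTop_atTop
  have h1 := ho.sum_range (fun k => (hgpos k).le) (by simpa only [hsum] using htop)
  simp only [hsum, Finset.sum_sub_distrib, ← Finset.mul_sum] at h1
  have h2 := (h1.tendsto_div_nhds_zero).add_const (L / γ)
  rw [zero_add] at h2
  refine h2.congr' ?_
  filter_upwards [eventually_gt_atTop 0] with k hk
  have hk' : (0 : ℝ) < k := by exact_mod_cast hk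
  have : 0 < (k : ℝ) ^ γ := by positivity
  field_simp
  ring

section Weights

variable {α b : ℕ → ℝ} {A B a e : ℝ}

theorem tendsto_weight_div_rpow
    (hα : Tendsto (fun n : ℕ => (α n)⁻¹ / (A * (n : ℝ) ^ a)) atTop (𝓝 1))
    (hb : Tendsto (fun n : ℕ => b n / (B * (n : ℝ) ^ e)) atTop (𝓝 1)) (hA : 0 < A) (hB : 0 < B)
    (s : ℕ) :
    Tendsto (fun n : ℕ => ((α n)⁻¹ ^ 2 * b n ^ s) / (n : ℝ) ^ (2 * a + e * s)) atTop
      (𝓝 (A ^ 2 * B ^ s)) := by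
  have h := (((hα.pow 2).mul (hb.pow s)).mul_const (A ^ 2 * B ^ s))
  simp only [one_pow, one_mul] at h
  refine h.congr' ?_
  filter_upwards [eventually_gt_atTop 0] with n hn
  have hn' : (0 : ℝ) < n := by exact_mod_cast hn
  have e1 : (n : ℝ) ^ (2 * a + e * s) = ((n : ℝ) ^ a) ^ 2 * ((n : ℝ) ^ e) ^ s := by
    rw [Real.rpow_add hn', Real.rpow_mul_natCast hn'.le, mul_comm 2 a]
    congr 1
    exact_mod_cast Real.rpow_mul_natCast hn'.le a 2
  have h1 : 0 < (n : ℝ) ^ a := by positivity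
  have h2 : 0 < (n : ℝ) ^ e := by positivity
  rw [e1, div_pow, div_pow, mul_pow, mul_pow]
  field_simp

theorem tendsto_rpow_mul_weight (hαp : ∀ n, 0 < α n) (hbp : ∀ n, 0 < b n)
    (hα : Tendsto (fun n : ℕ => (α n)⁻¹ / (A * (n : ℝ) ^ a)) atTop (𝓝 1))
    (hb : Tendsto (fun n : ℕ => b n / (B * (n : ℝ) ^ e)) atTop (𝓝 1)) (hA : 0 < A) (hB : 0 < B)
    (s : ℕ) :
    Tendsto (fun n : ℕ => (n : ℝ) ^ (2 * a + e * s + 1) * (α n ^ 2 / (n * b n ^ s))) atTop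
      (𝓝 (A ^ 2 * B ^ s)⁻¹) := by
  refine ((tendsto_weight_div_rpow hα hb hA hB s).inv₀ (by positivity)).congr' ?_
  filter_upwards [eventually_gt_atTop 0] with n hn
  have hn' : (0 : ℝ) < n := by exact_mod_cast hn
  have := hαp n
  have := hbp n
  rw [Real.rpow_add_one hn'.ne']
  field_simp

theorem tendsto_weight_zero (hαp : ∀ n, 0 < α n) (hbp : ∀ n, 0 < b n)
    (hα : Tendsto (fun n : ℕ => (α n)⁻¹ / (A * (n : ℝ) ^ a)) atTop (𝓝 1))
    (hb : Tendsto (fun n : ℕ => b n / (B * (n : ℝ) ^ e)) atTop (𝓝 1)) (hA : 0 < A) (hB : 0 < B)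
    (s : ℕ) (hs : 0 < 2 * a + e * s + 1) :
    Tendsto (fun n : ℕ => α n ^ 2 / (n * b n ^ s)) atTop (𝓝 0) := by
  have h1 : Tendsto (fun n : ℕ => ((n : ℝ) ^ (2 * a + e * s + 1))⁻¹) atTop (𝓝 0) :=
    tendsto_inv_atTop_zero.comp ((tendsto_rpow_atTop hs).comp tendsto_natCast_atTop_atTop)
  have h2 := h1.mul (tendsto_rpow_mul_weight hαp hbp hα hb hA hB s)
  rw [zero_mul] at h2
  refine h2.congr' ?_
  filter_upwards [eventually_gt_atTop 0] with n hn
  have hn' : (0 : ℝ) < n := by exact_mod_cast hn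
  have : 0 < (n : ℝ) ^ (2 * a + e * s + 1) := by positivity
  field_simp

theorem tendsto_weighted_average (hαp : ∀ n, 0 < α n) (hbp : ∀ n, 0 < b n)
    (hα : Tendsto (fun n : ℕ => (α n)⁻¹ / (A * (n : ℝ) ^ a)) atTop (𝓝 1))
    (hb : Tendsto (fun n : ℕ => b n / (B * (n : ℝ) ^ e)) atTop (𝓝 1)) (hA : 0 < A) (hB : 0 < B)
    (s : ℕ) (hs : 0 < 2 * a + e * s + 1) {y : ℕ → ℝ} {Y : ℝ} (hy : Tendsto y atTop (𝓝 Y)) :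
    Tendsto (fun n : ℕ => α n ^ 2 / (n * b n ^ s) *
      ∑ k ∈ Finset.range n, (α k)⁻¹ ^ 2 * b k ^ s * y k) atTop
      (𝓝 (Y / (2 * a + e * s + 1))) := by
  have h1 : Tendsto (fun k : ℕ => ((α k)⁻¹ ^ 2 * b k ^ s * y k) / (k : ℝ) ^ (2 * a + e * s)) atTop
      (𝓝 (A ^ 2 * B ^ s * Y)) :=
    ((tendsto_weight_div_rpow hα hb hA hB s).mul hy).congr fun k => by ring
  have h2 := (tendsto_rpow_mul_weight hαp hbp hα hb hA hB s).mul
    (tendsto_sum_range_div_rpow hs h1)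
  have e1 : (A ^ 2 * B ^ s)⁻¹ * (A ^ 2 * B ^ s * Y / (2 * a + e * s + 1)) =
      Y / (2 * a + e * s + 1) := by field_simp
  rw [e1] at h2
  refine h2.congr' ?_
  filter_upwards [eventually_gt_atTop 0] with n hn
  have hn' : (0 : ℝ) < n := by exact_mod_cast hn
  have : 0 < (n : ℝ) ^ (2 * a + e * s + 1) := by positivity
  field_simp

theorem exists_forall_lt_le_mul (hbp : ∀ n, 0 < b n)
    (hb : Tendsto (fun n : ℕ => b n / (B * (n : ℝ) ^ e)) atTop (𝓝 1)) (hB : 0 < B) (he : 0 < e) :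
    ∃ C > 0, ∀ᶠ n in atTop, ∀ k < n, b k ≤ C * b n := by
  obtain ⟨N, hN⟩ := eventually_atTop.1
    ((hb.eventually (Ioo_mem_nhds (show (1 / 2 : ℝ) < 1 by norm_num) (show (1 : ℝ) < 2 by norm_num))).and
      (eventually_gt_atTop 0))
  have hbd : ∀ n ≥ N, 0 < (n : ℝ) ^ e ∧ B * (n : ℝ) ^ e < 2 * b n ∧ b n < 2 * (B * (n : ℝ) ^ e) := by
    intro n hn
    obtain ⟨⟨h1, h2⟩, h3⟩ := hN n hn
    have hn' : (0 : ℝ) < n := by exact_mod_cast h3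
    have h4 : 0 < (n : ℝ) ^ e := by positivity
    rw [lt_div_iff₀ (by positivity)] at h1
    rw [div_lt_iff₀ (by positivity)] at h2
    exact ⟨h4, by linarith, h2⟩
  set D := ∑ k ∈ Finset.range N, b k
  have hD : 0 ≤ D := Finset.sum_nonneg fun i _ => (hbp i).le
  refine ⟨4 + 2 * D / B, by positivity, ?_⟩
  filter_upwards [eventually_ge_atTop N, eventually_gt_atTop 0] with n hn hn0 k hk
  obtain ⟨h1, h2, h3⟩ := hbd n hn
  have h5 : 0 ≤ D / B * (b n) := by have := hbp n; positivity
  have h6 := hbp n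
  rcases lt_or_ge k N with h | h
  · have h4 : b k ≤ D := Finset.single_le_sum (fun i _ => (hbp i).le) (Finset.mem_range.2 h)
    have h7 : (1 : ℝ) ≤ (n : ℝ) ^ e :=
      Real.one_le_rpow (by exact_mod_cast hn0) he.le
    have h8 : D ≤ D / B * (2 * b n) := by
      have : D / B * B ≤ D / B * (2 * b n) := by
        gcongr
        nlinarith
      rwa [div_mul_cancel₀ _ hB.ne'] at this
    have : (4 + 2 * D / B) * b n = 4 * b n + D / B * (2 * b n) := by ring
    linarith
  · obtain ⟨h1', h2', h3'⟩ := hbd k h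
    have h4 : (k : ℝ) ^ e ≤ (n : ℝ) ^ e := by gcongr
    have h7 : B * (k : ℝ) ^ e ≤ B * (n : ℝ) ^ e := by gcongr
    have : (4 + 2 * D / B) * b n = 4 * b n + 2 * (D / B * b n) := by ring
    linarith

end Weights

/-- The numerator of `∑ i, c i / (X + x + i)` over the common denominator. -/
def partialFracNum {N : ℕ} (x : ℝ) (c : Fin N → ℝ) : ℝ[X] :=
  ∑ i, C (c i) * ∏ l ∈ Finset.univ.erase i, (X + C (x + (l : ℕ)))

theorem degree_partialFracNum_lt {N : ℕ} (x : ℝ) (c : Fin N → ℝ) :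
    (partialFracNum x c).degree < N := by
  refine (Polynomial.degree_sum_le _ _).trans_lt ?_
  rw [Finset.sup_lt_iff (by exact_mod_cast WithBot.bot_lt_coe N)]
  intro i _
  have hm : (∏ l ∈ Finset.univ.erase i, (X + C (x + (l : ℕ)))).natDegree = N - 1 := by
    rw [natDegree_prod_of_monic _ _ fun l _ => monic_X_add_C _]
    simp only [natDegree_X_add_C]
    simp
  have hN : 0 < N := i.pos
  refine degree_le_natDegree.trans_lt ?_
  have h1 := (natDegree_C_mul_le (c i) _).trans_eq hm
  exact_mod_cast h1.trans_lt (Nat.sub_lt hN one_pos)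

theorem eval_partialFracNum {N : ℕ} {x t : ℝ} (hx : 0 < x) (ht : 0 ≤ t) (c : Fin N → ℝ) :
    (partialFracNum x c).eval t = (∏ l : Fin N, (x + (l : ℕ) + t)) * ∑ i, c i / (x + (i : ℕ) + t) := by
  rw [partialFracNum, eval_finsetSum, Finset.mul_sum]
  refine Finset.sum_congr rfl fun i _ => ?_
  rw [← Finset.mul_prod_erase _ _ (Finset.mem_univ i), eval_mul, eval_C, eval_prod]
  have h1 : ∀ l : Fin N, (X + C (x + (l : ℕ)) : ℝ[X]).eval t = x + (l : ℕ) + t := fun l => by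
    simp; ring
  simp only [h1]
  have : 0 < x + (i : ℕ) + t := by positivity
  field_simp

theorem eq_zero_of_cauchy_sum_eq_zero {N : ℕ} {x : ℝ} (hx : 0 < x) {c : Fin N → ℝ}
    (h : ∀ m : Fin N, ∑ i, c i / (x + (i : ℕ) + (m : ℕ)) = 0) : c = 0 := by
  have h0 : partialFracNum x c = 0 := by
    refine eq_of_degrees_lt_of_eval_index_eq (v := fun m : Fin N => ((m : ℕ) : ℝ)) Finset.univ
      (fun i _ j _ hij => Fin.ext (Nat.cast_injective (R := ℝ) hij)) ?_ ?_ fun m _ => ?_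
    · simpa using degree_partialFracNum_lt x c
    · simp
    · rw [eval_partialFracNum hx (by positivity), h m]
      simp
  funext j
  have h1 := congrArg (eval (-(x + (j : ℕ)))) h0
  rw [partialFracNum, eval_finsetSum, Finset.sum_eq_single j] at h1
  · rw [eval_mul, eval_C, eval_prod, eval_zero, mul_eq_zero] at h1
    refine h1.resolve_right (Finset.prod_ne_zero_iff.2 fun l hl => ?_)
    simp only [eval_add, eval_X, eval_C]
    intro h2
    have h3 : ((l : ℕ) : ℝ) = (j : ℕ) := by linarith
    exact (Finset.mem_erase.1 hl).1 (Fin.ext (by exact_mod_cast h3))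
  · intro i _ hij
    rw [eval_mul, eval_prod, Finset.prod_eq_zero (i := j), mul_zero]
    · simp [hij.symm]
    · simp
  · simp

theorem one_sub_cauchy_sum {N : ℕ} {x : ℝ} (hx : 0 < x) {c : Fin N → ℝ}
    (h : ∀ m : Fin N, ∑ i, c i / (x + (i : ℕ) + (m : ℕ)) = 1) {t : ℝ} (ht : 0 ≤ t) :
    1 - ∑ i, c i / (x + (i : ℕ) + t) =
      (∏ l : Fin N, (t - (l : ℕ))) / ∏ l : Fin N, (x + (l : ℕ) + t) := by
  set D : ℝ[X] := ∏ l : Fin N, (X + C (x + (l : ℕ)))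
  set E : ℝ[X] := ∏ l : Fin N, (X - C ((l : ℕ) : ℝ))
  have hDm : D.Monic := monic_prod_of_monic _ _ fun l _ => monic_X_add_C _
  have hEm : E.Monic := monic_prod_of_monic _ _ fun l _ => monic_X_sub_C _
  have hDd : D.degree = N := by
    rw [degree_prod_of_monic _ _ fun l _ => monic_X_add_C _]
    simp only [degree_X_add_C]
    simp
  have hEd : E.degree = N := by
    rw [degree_prod_of_monic _ _ fun l _ => monic_X_sub_C _]
    simp only [degree_X_sub_C]
    simp
  have hDE : (D - E).degree < N := by
    rw [← hDd]
    exact degree_sub_lt_left (hDd.trans hEd.symm) hDm.ne_zero (by rw [hDm, hEm])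
  have hDev : ∀ t, D.eval t = ∏ l : Fin N, (x + (l : ℕ) + t) := fun t => by
    rw [eval_prod]
    exact Finset.prod_congr rfl fun l _ => by simp; ring
  have hEev : ∀ t, E.eval t = ∏ l : Fin N, (t - (l : ℕ)) := fun t => by
    rw [eval_prod]
    exact Finset.prod_congr rfl fun l _ => by simp
  have heq : D - E = partialFracNum x c := by
    refine eq_of_degrees_lt_of_eval_index_eq (v := fun m : Fin N => ((m : ℕ) : ℝ)) Finset.univ
      (fun i _ j _ hij => Fin.ext (Nat.cast_injective (R := ℝ) hij)) ?_ ?_ fun m _ => ?_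
    · simpa using hDE
    · simpa using degree_partialFracNum_lt x c
    · rw [eval_partialFracNum hx (by positivity), h m, eval_sub, hDev, hEev,
        Finset.prod_eq_zero (f := fun l : Fin N => ((m : ℕ) : ℝ) - (l : ℕ)) (Finset.mem_univ m)
          (sub_self _)]
      simp
  have h1 := congrArg (eval t) heq
  rw [eval_sub, eval_partialFracNum hx ht, hDev, hEev] at h1
  have hpos : 0 < ∏ l : Fin N, (x + (l : ℕ) + t) := Finset.prod_pos fun l _ => by positivity
  rw [eq_div_iff hpos.ne']
  linarith

/-- The coefficients of `phi ν` as a power series in `z ^ 2`. -/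
def besselCoeff (ν : ℝ) (m : ℕ) : ℝ :=
  (-1) ^ m / (m.factorial * Real.Gamma (m + ν + 1))

theorem besselCoeff_ne_zero {ν : ℝ} (hν : -1 < ν) (m : ℕ) : besselCoeff ν m ≠ 0 := by
  have : 0 < Real.Gamma (m + ν + 1) := Real.Gamma_pos_of_pos (by
    have : (0 : ℝ) ≤ m := m.cast_nonneg
    linarith)
  have h2 : (0 : ℝ) < m.factorial := by exact_mod_cast m.factorial_pos
  exact div_ne_zero (by simp) (by positivity)

theorem phi_eq_tsum (ν : ℝ) (z : ℂ) : phi ν z = ∑' m, (besselCoeff ν m : ℂ) * (z ^ 2) ^ m := by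
  refine tsum_congr fun m => ?_
  rw [besselCoeff, ← pow_mul]
  push_cast [← Complex.Gamma_ofReal]
  ring

theorem summable_besselCoeff {ν : ℝ} (hν : -1 < ν) (z : ℂ) :
    Summable fun m => (besselCoeff ν m : ℂ) * z ^ m := by
  by_cases hz : z = 0
  · subst hz
    refine summable_of_ne_finset_zero (s := {0}) fun m hm => ?_
    have : m ≠ 0 := by simpa using hm
    simp [this]
  have hratio : ∀ m : ℕ, besselCoeff ν (m + 1) =
      besselCoeff ν m * (-1 / ((m + 1) * (m + ν + 1))) := by
    intro m
    have h0 : (0 : ℝ) < m + ν + 1 := by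
      have : (0 : ℝ) ≤ m := m.cast_nonneg
      linarith
    have h1 : 0 < Real.Gamma (m + ν + 1) := Real.Gamma_pos_of_pos h0
    have h2 : Real.Gamma (((m + 1 : ℕ) : ℝ) + ν + 1) = (m + ν + 1) * Real.Gamma (m + ν + 1) := by
      rw [← Real.Gamma_add_one h0.ne']
      congr 1
      push_cast
      ring
    rw [besselCoeff, besselCoeff, h2, Nat.factorial_succ]
    have h3 : (0 : ℝ) < m.factorial := by exact_mod_cast m.factorial_pos
    push_cast
    field_simp
    ring
  refine summable_of_ratio_test_tendsto_lt_one (l := 0) one_pos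
    (Eventually.of_forall fun m => mul_ne_zero (by exact_mod_cast besselCoeff_ne_zero hν m)
      (pow_ne_zero _ hz)) ?_
  have ht1 : Tendsto (fun m : ℕ => ((m : ℝ) + 1)⁻¹) atTop (𝓝 0) :=
    tendsto_inv_atTop_zero.comp (tendsto_atTop_add_const_right _ _ tendsto_natCast_atTop_atTop)
  have ht2 : Tendsto (fun m : ℕ => ((m : ℝ) + (ν + 1))⁻¹) atTop (𝓝 0) :=
    tendsto_inv_atTop_zero.comp (tendsto_atTop_add_const_right _ _ tendsto_natCast_atTop_atTop)
  have ht := (ht1.mul ht2).mul_const ‖z‖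
  simp only [mul_zero, zero_mul] at ht
  refine ht.congr fun m => ?_
  have h0 : (0 : ℝ) < m + (ν + 1) := by
    have : (0 : ℝ) ≤ m := m.cast_nonneg
    linarith
  have h4 : ‖besselCoeff ν m‖ ≠ 0 := norm_ne_zero_iff.2 (besselCoeff_ne_zero hν m)
  have h5 : ‖z‖ ≠ 0 := norm_ne_zero_iff.2 hz
  rw [norm_mul, norm_mul, Complex.norm_real, Complex.norm_real, hratio, norm_pow, norm_pow, norm_mul,
    norm_div, norm_neg, norm_one, norm_mul, Real.norm_of_nonneg (by positivity : (0 : ℝ) ≤ m + 1),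
    add_assoc (m : ℝ) ν 1, Real.norm_of_nonneg h0.le]
  field_simp
  ring

theorem Gamma_add_natCast {x : ℝ} (hx : 0 < x) (N : ℕ) :
    Real.Gamma (x + N) = (∏ l : Fin N, (x + (l : ℕ))) * Real.Gamma x := by
  induction N with
  | zero => simp
  | succ N ih =>
    rw [Fin.prod_univ_castSucc, Nat.cast_succ, ← add_assoc, Real.Gamma_add_one (by positivity), ih]
    simp
    ring

theorem besselCoeff_mul_prod {ν : ℝ} (hν : -1 < ν) (N m : ℕ) :
    besselCoeff ν m * ((∏ l : Fin N, ((m : ℝ) - (l : ℕ))) /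
      ∏ l : Fin N, (ν + 1 + (l : ℕ) + m)) =
      if m < N then 0 else (-1) ^ N * besselCoeff (ν + 2 * N) (m - N) := by
  split_ifs with h
  · rw [Finset.prod_eq_zero (i := ⟨m, h⟩) (Finset.mem_univ _) (by simp)]
    simp
  · obtain ⟨k, rfl⟩ := Nat.exists_eq_add_of_le' (not_lt.1 h)
    have hx : 0 < ((k + N : ℕ) : ℝ) + ν + 1 := by
      have : (0 : ℝ) ≤ (k + N : ℕ) := Nat.cast_nonneg _
      linarith
    have hG : Real.Gamma (k + (ν + 2 * N) + 1) =
        (∏ l : Fin N, (ν + 1 + (l : ℕ) + (k + N : ℕ))) * Real.Gamma ((k + N : ℕ) + ν + 1) := by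
      have := Gamma_add_natCast hx N
      rw [show (k : ℝ) + (ν + 2 * N) + 1 = ((k + N : ℕ) : ℝ) + ν + 1 + N by push_cast; ring, this]
      congr 1
      exact Finset.prod_congr rfl fun l _ => by ring
    have hF : ((k + N).factorial : ℝ) =
        k.factorial * ∏ l : Fin N, (((k + N : ℕ) : ℝ) - (l : ℕ)) := by
      have h1 := Nat.factorial_mul_descFactorial (Nat.le_add_left N k)
      rw [Nat.add_sub_cancel] at h1
      rw [← h1, Nat.cast_mul, ← descPochhammer_eval_eq_descFactorial,
        descPochhammer_eval_eq_prod_range, Finset.prod_range]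
    rw [Nat.add_sub_cancel, besselCoeff, besselCoeff, hG, hF]
    have h2 : 0 < Real.Gamma ((k + N : ℕ) + ν + 1) := Real.Gamma_pos_of_pos hx
    have h3 : (0 : ℝ) < k.factorial := by exact_mod_cast k.factorial_pos
    have h4 : 0 < ∏ l : Fin N, (((k + N : ℕ) : ℝ) - (l : ℕ)) := Finset.prod_pos fun l _ => by
      have : ((l : ℕ) : ℝ) < N := by exact_mod_cast l.2
      have : (0 : ℝ) ≤ k := k.cast_nonneg
      push_cast
      linarith
    have h5 : 0 < ∏ l : Fin N, (ν + 1 + (l : ℕ) + (k + N : ℕ)) := Finset.prod_pos fun l _ => by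
      have : (0 : ℝ) ≤ (l : ℕ) := Nat.cast_nonneg _
      linarith
    field_simp
    ring

theorem exists_sum_smul_eq {p : ℕ → ℝ[X]} (hp : ∀ n, (p n).degree = n) (N : ℕ) {f : ℝ[X]}
    (hf : f.degree < N) : ∃ α : ℕ → ℝ, f = ∑ k ∈ Finset.range N, α k • p k := by
  induction N generalizing f with
  | zero => exact ⟨0, by simpa using hf⟩
  | succ N ih =>
    have hlc : (p N).coeff N ≠ 0 := by
      have := leadingCoeff_ne_zero.2 (ne_zero_of_degree_gt (n := ⊥) (by rw [hp]; exact WithBot.bot_lt_coe N))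
      rwa [leadingCoeff, natDegree_eq_of_degree_eq_some (hp N)] at this
    set t := f.coeff N / (p N).coeff N
    have h1 : (f - t • p N).degree < N := by
      rw [degree_lt_iff_coeff_zero]
      intro m hm
      rw [coeff_sub, coeff_smul, smul_eq_mul]
      rcases hm.eq_or_lt with rfl | hm
      · rw [div_mul_cancel₀ _ hlc, sub_self]
      · rw [(degree_lt_iff_coeff_zero _ _).1 hf m hm, coeff_eq_zero_of_degree_lt, mul_zero, sub_self]
        rw [hp]
        exact_mod_cast hm
    obtain ⟨α, hα⟩ := ih h1
    refine ⟨Function.update α N t, ?_⟩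
    rw [Finset.sum_range_succ, Function.update_self,
      Finset.sum_congr rfl fun k hk => by
        rw [Function.update_of_ne (Finset.mem_range.1 hk).ne], ← hα]
    simp

/-- Expansion of the orthonormal polynomials for a finite rank perturbation of `Λ` in terms of those
for `Λ`. -/
theorem sobolev_connection {N : ℕ} {Λ : ℝ[X] →ₗ[ℝ] ℝ} {ℓ : ℕ → ℝ[X] →ₗ[ℝ] ℝ} {M : Fin N → ℝ}
    {p q : ℕ → ℝ[X]} (hpd : ∀ n, (p n).degree = n) (hpl : ∀ n, 0 < (p n).leadingCoeff)
    (hpo : ∀ n m, Λ (p n * p m) = if n = m then 1 else 0)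
    (hqd : ∀ n, (q n).degree = n) (hql : ∀ n, 0 < (q n).leadingCoeff)
    (hqo : ∀ n m, Λ (q n * q m) + ∑ i, M i * ℓ i (q n) * ℓ i (q m) = if n = m then 1 else 0)
    (n : ℕ) :
    ∃ γ > 0, q n = γ • p n -
        ∑ k ∈ Finset.range n, (∑ i, M i * ℓ i (q n) * ℓ i (p k)) • p k ∧
      γ * (γ + ∑ i, M i * ℓ i (q n) * ℓ i (p n)) = 1 := by
  obtain ⟨α, hα⟩ := exists_sum_smul_eq hpd (n + 1) (f := q n)
    (by rw [hqd]; exact_mod_cast n.lt_succ_self)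
  have hαΛ : ∀ k ≤ n, Λ (q n * p k) = α k := by
    intro k hk
    rw [hα, Finset.sum_mul, map_sum, Finset.sum_eq_single k]
    · simp [hpo]
    · intro j _ hj
      simp [hpo, hj]
    · intro h
      exact absurd (Finset.mem_range.2 (Nat.lt_succ_of_le hk)) h
  set S : ℝ[X] →ₗ[ℝ] ℝ := Λ ∘ₗ LinearMap.mulLeft ℝ (q n) + ∑ i, (M i * ℓ i (q n)) • ℓ i with hS
  have hSa : ∀ f, S f = Λ (q n * f) + ∑ i, M i * ℓ i (q n) * ℓ i f := fun f => by
    simp [hS, LinearMap.sum_apply]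
  have hSp : ∀ k < n, S (p k) = 0 := by
    intro k hk
    obtain ⟨β, hβ⟩ := exists_sum_smul_eq hqd n (f := p k) (by rw [hpd]; exact_mod_cast hk)
    rw [hβ, map_sum]
    refine Finset.sum_eq_zero fun j hj => ?_
    rw [map_smul, hSa, hqo, if_neg (Finset.mem_range.1 hj).ne', smul_zero]
  have hαk : ∀ k < n, α k = -∑ i, M i * ℓ i (q n) * ℓ i (p k) := by
    intro k hk
    have := hSp k hk
    rw [hSa, hαΛ k hk.le] at this
    linarith
  refine ⟨α n, ?_, ?_, ?_⟩
  · have h1 := congrArg (fun f => coeff f n) hα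
    simp only [Finset.sum_range_succ, coeff_add, finsetSum_coeff, coeff_smul, smul_eq_mul] at h1
    rw [Finset.sum_eq_zero, zero_add] at h1
    · have h2 := hpl n
      have h3 := hql n
      rw [leadingCoeff, natDegree_eq_of_degree_eq_some (hpd n)] at h2
      rw [leadingCoeff, natDegree_eq_of_degree_eq_some (hqd n), h1] at h3
      exact (pos_iff_pos_of_mul_pos h3).2 h2
    · intro k hk
      rw [coeff_eq_zero_of_degree_lt, mul_zero]
      rw [hpd]
      exact_mod_cast Finset.mem_range.1 hk
  · nth_rewrite 1 [hα]
    rw [Finset.sum_range_succ, sub_eq_add_neg, ← Finset.sum_neg_distrib, add_comm]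
    congr 1
    refine Finset.sum_congr rfl fun k hk => ?_
    rw [hαk k (Finset.mem_range.1 hk), neg_smul]
  · have h1 : S (q n) = 1 := by rw [hSa, hqo, if_pos rfl]
    rw [hα] at h1
    rw [map_sum, Finset.sum_range_succ, Finset.sum_eq_zero, zero_add, map_smul, hSa,
      hαΛ n le_rfl, smul_eq_mul] at h1
    · exact h1
    · intro k hk
      rw [map_smul, hSp k (Finset.mem_range.1 hk), smul_zero]

/-- The Taylor coefficients at `c`, as linear functionals. -/
def taylorCoeff (c : ℝ) (m : ℕ) : ℝ[X] →ₗ[ℝ] ℝ :=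
  lcoeff ℝ m ∘ₗ taylor c

theorem taylorCoeff_apply (c : ℝ) (m : ℕ) (f : ℝ[X]) :
    taylorCoeff c m f = (taylor c f).coeff m := rfl

theorem eval_iterate_derivative (c : ℝ) (m : ℕ) (f : ℝ[X]) :
    (derivative^[m] f).eval c = m.factorial * taylorCoeff c m f := by
  rw [taylorCoeff_apply, taylor_coeff, ← factorial_smul_hasseDeriv]
  simp

theorem aeval_eq_tsum_taylorCoeff (c : ℝ) (f : ℝ[X]) (w : ℂ) :
    aeval ((c : ℂ) + w) f = ∑' m, (taylorCoeff c m f : ℂ) * w ^ m := by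
  have h1 : aeval ((c : ℂ) + w) f = aeval w (taylor c f) := by
    rw [taylor_apply, aeval_comp]
    simp [add_comm]
  rw [h1, aeval_eq_sum_range, tsum_eq_sum (s := Finset.range ((taylor c f).natDegree + 1))]
  · simp [taylorCoeff_apply]
  · intro m hm
    rw [taylorCoeff_apply, coeff_eq_zero_of_natDegree_lt (by rw [Finset.mem_range] at hm; lia)]
    simp

theorem summable_taylorCoeff (c : ℝ) (f : ℝ[X]) (w : ℕ → ℂ) :
    Summable fun m => (taylorCoeff c m f : ℂ) * w m := by
  refine summable_of_ne_finset_zero (s := Finset.range ((taylor c f).natDegree + 1)) fun m hm => ?_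
  rw [taylorCoeff_apply, coeff_eq_zero_of_natDegree_lt (by rw [Finset.mem_range] at hm; lia)]
  simp

/-- Solutions of linear systems converge when the systems converge to an invertible one. -/
theorem exists_tendsto_of_mulVec_eq {N : ℕ} {T : ℕ → Matrix (Fin N) (Fin N) ℝ}
    {T₀ : Matrix (Fin N) (Fin N) ℝ} {u v : ℕ → Fin N → ℝ} {v₀ : Fin N → ℝ}
    (hT : Tendsto T atTop (𝓝 T₀)) (hdet : T₀.det ≠ 0) (hv : Tendsto v atTop (𝓝 v₀))
    (hu : ∀ᶠ n in atTop, (T n).mulVec (u n) = v n) :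
    ∃ u₀, Tendsto u atTop (𝓝 u₀) ∧ T₀.mulVec u₀ = v₀ := by
  have hd : Tendsto (fun n => (T n).det) atTop (𝓝 T₀.det) :=
    ((continuous_id.matrix_det).tendsto T₀).comp hT
  have ha : Tendsto (fun n => (T n).adjugate) atTop (𝓝 T₀.adjugate) :=
    ((continuous_id.matrix_adjugate).tendsto T₀).comp hT
  have hmul : Continuous fun x : Matrix (Fin N) (Fin N) ℝ × (Fin N → ℝ) => x.1.mulVec x.2 :=
    continuous_fst.matrix_mulVec continuous_snd
  have hlim : Tendsto u atTop (𝓝 (T₀.det⁻¹ • T₀.adjugate.mulVec v₀)) := by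
    refine ((hd.inv₀ hdet).smul ((hmul.tendsto (T₀.adjugate, v₀)).comp
      (ha.prodMk_nhds hv))).congr' ?_
    filter_upwards [hu, hd.eventually_ne hdet] with n hn hn'
    simp only [Function.comp]
    rw [← hn, Matrix.mulVec_mulVec, Matrix.adjugate_mul, Matrix.smul_mulVec, Matrix.one_mulVec,
      smul_smul, inv_mul_cancel₀ hn', one_smul]
  refine ⟨_, hlim, tendsto_nhds_unique (((hmul.tendsto (T₀, _)).comp (hT.prodMk_nhds hlim)).congr'
    ?_) hv⟩
  filter_upwards [hu] with n hn using hn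

/-- Asymptotics of the Taylor coefficients of discrete Sobolev orthonormal polynomials, given those
of the unperturbed ones. -/
theorem tendsto_sobolev_coeff {N : ℕ} {h g : ℕ → ℕ → ℝ} {γ α b : ℕ → ℝ} {M : Fin N → ℝ}
    {A B a e ν : ℝ} (hM : ∀ i, 0 < M i) (hγ : ∀ n, 0 < γ n)
    (hg : ∀ n m, g n m = γ n * h n m -
      ∑ k ∈ Finset.range n, (∑ i : Fin N, M i * g n i * h k i) * h k m)
    (hgγ : ∀ n, γ n * (γ n + ∑ i : Fin N, M i * g n i * h n i) = 1)
    (hαp : ∀ n, 0 < α n) (hbp : ∀ n, 0 < b n)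
    (hα : Tendsto (fun n : ℕ => (α n)⁻¹ / (A * (n : ℝ) ^ a)) atTop (𝓝 1))
    (hb : Tendsto (fun n : ℕ => b n / (B * (n : ℝ) ^ e)) atTop (𝓝 1))
    (hA : 0 < A) (hB : 0 < B) (he : 0 < e) (hν : -1 < ν) (hlink : 2 * a + 1 = e * (ν + 1))
    (hlim : ∀ m, Tendsto (fun n => (-1) ^ n * α n / b n ^ m * h n m) atTop (𝓝 (besselCoeff ν m)))
    (hbd : ∀ R > 0, ∃ C, ∀ n m, |(-1) ^ n * α n / b n ^ m * h n m| ≤ C / R ^ m) :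
    (∀ m, Tendsto (fun n => (-1) ^ n * α n / b n ^ m * g n m) atTop
      (𝓝 (if m < N then 0 else (-1) ^ N * besselCoeff (ν + 2 * N) (m - N)))) ∧
    ∀ R > 0, ∃ C, ∀ᶠ n in atTop, ∀ m, |(-1) ^ n * α n / b n ^ m * g n m| ≤ C / R ^ m := by
  set π : ℕ → ℕ → ℝ := fun n m => (-1) ^ n * α n / b n ^ m * h n m with hπ
  have hsq : ∀ n : ℕ, ((-1 : ℝ) ^ n) * (-1) ^ n = 1 := fun n => by rw [← mul_pow]; simp
  have hhπ : ∀ k i m, h k i * h k m = (α k)⁻¹ ^ 2 * b k ^ (i + m) * (π k i * π k m) := by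
    intro k i m
    have h1 := (hαp k).ne'
    have h2 := (hbp k).ne'
    calc h k i * h k m = ((-1 : ℝ) ^ k * (-1) ^ k) * (h k i * h k m) := by rw [hsq, one_mul]
      _ = _ := by simp only [hπ, pow_add]; field_simp
  have hpos : ∀ s : ℕ, 0 < 2 * a + e * s + 1 := fun s => by
    have h1 : 0 < e * (ν + 1) := mul_pos he (by linarith)
    have h2 : 0 ≤ e * s := by positivity
    linarith
  set S : ℕ → ℕ → ℕ → ℝ := fun n i m => α n ^ 2 / (n * b n ^ (i + m)) *
      ∑ k ∈ Finset.range n, h k i * h k m with hS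
  have hSlim : ∀ i m : ℕ, Tendsto (fun n => S n i m) atTop
      (𝓝 (besselCoeff ν i * besselCoeff ν m / (e * (ν + 1 + i + m)))) := by
    intro i m
    have h1 := tendsto_weighted_average hαp hbp hα hb hA hB (i + m) (hpos _)
      ((hlim i).mul (hlim m))
    have h2 : 2 * a + e * ((i + m : ℕ) : ℝ) + 1 = e * (ν + 1 + i + m) := by
      push_cast
      linarith
    rw [h2] at h1
    refine h1.congr fun n => ?_
    simp only [hS, hhπ]
    rfl
  set u : ℕ → Fin N → ℝ := fun n i =>
    M i * g n i * n * b n ^ (i : ℕ) * (-1) ^ n / (α n * γ n) with hu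
  set G : ℕ → ℕ → ℝ := fun n m => (-1) ^ n * α n / b n ^ m * g n m / γ n with hG
  have hMg : ∀ n > 0, ∀ i : Fin N, M i * g n i =
      γ n * ((-1) ^ n * α n / (n * b n ^ (i : ℕ)) * u n i) := by
    intro n hn i
    have h0 : (n : ℝ) ≠ 0 := by exact_mod_cast hn.ne'
    have h1 := (hαp n).ne'
    have h2 := (hbp n).ne'
    have h3 := (hγ n).ne'
    calc M i * g n i = ((-1 : ℝ) ^ n * (-1) ^ n) * (M i * g n i) := by rw [hsq, one_mul]
      _ = _ := by simp only [hu]; field_simp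
  have hG1 : ∀ n > 0, ∀ m, G n m = π n m - ∑ i, u n i * S n i m := by
    intro n hn m
    have h0 : (n : ℝ) ≠ 0 := by exact_mod_cast hn.ne'
    have h1 := (hαp n).ne'
    have h2 := (hbp n).ne'
    have h3 := (hγ n).ne'
    have h4 : ∑ k ∈ Finset.range n, (∑ i : Fin N, M i * g n i * h k i) * h k m =
        ∑ i : Fin N, M i * g n i * ∑ k ∈ Finset.range n, h k i * h k m := by
      simp only [Finset.sum_mul, Finset.mul_sum]
      rw [Finset.sum_comm]
      simp only [mul_assoc]
    have h5 : ∀ i : Fin N, (-1) ^ n * α n / b n ^ m / γ n *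
        (M i * g n i * ∑ k ∈ Finset.range n, h k i * h k m) = u n i * S n i m := by
      intro i
      rw [hMg n hn i]
      calc _ = ((-1 : ℝ) ^ n * (-1) ^ n) * (u n i * S n i m) := by
            simp only [hS, pow_add]
            field_simp
        _ = _ := by rw [hsq, one_mul]
    calc G n m = (-1) ^ n * α n / b n ^ m / γ n * g n m := by simp only [hG]; ring
      _ = (-1) ^ n * α n / b n ^ m / γ n * (γ n * h n m) -
          ∑ i, (-1) ^ n * α n / b n ^ m / γ n *
            (M i * g n i * ∑ k ∈ Finset.range n, h k i * h k m) := by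
          rw [hg, h4, mul_sub, Finset.mul_sum]
      _ = _ := by
          simp only [h5]
          congr 1
          simp only [hπ]
          field_simp
  set ε : ℕ → Fin N → ℝ := fun n i => α n ^ 2 / (n * b n ^ (2 * (i : ℕ))) / M i with hε
  have hεlim : ∀ i, Tendsto (fun n => ε n i) atTop (𝓝 0) := fun i => by
    simpa using (tendsto_weight_zero hαp hbp hα hb hA hB (2 * (i : ℕ)) (hpos _)).div_const (M i)
  have hG2 : ∀ n > 0, ∀ i : Fin N, G n i = ε n i * u n i := by
    intro n hn i
    have h0 : (n : ℝ) ≠ 0 := by exact_mod_cast hn.ne'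
    have h1 := (hαp n).ne'
    have h2 := (hbp n).ne'
    have h3 := (hγ n).ne'
    have h4 := (hM i).ne'
    simp only [hG, hε, hu, two_mul, pow_add]
    field_simp
  set T : ℕ → Matrix (Fin N) (Fin N) ℝ := fun n => Matrix.of fun m i =>
    S n i m + if m = i then ε n i else 0 with hT
  set T₀ : Matrix (Fin N) (Fin N) ℝ := Matrix.of fun m i =>
    besselCoeff ν (i : ℕ) * besselCoeff ν (m : ℕ) / (e * (ν + 1 + (i : ℕ) + (m : ℕ))) with hT₀
  have hφ := besselCoeff_ne_zero hν
  have hx : 0 < ν + 1 := by linarith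
  have hTlim : Tendsto T atTop (𝓝 T₀) := by
    refine tendsto_pi_nhds.2 fun m => tendsto_pi_nhds.2 fun i => ?_
    have h1 : Tendsto (fun n => if m = i then ε n i else 0) atTop (𝓝 0) := by
      split_ifs
      · exact hεlim i
      · exact tendsto_const_nhds
    simpa [hT, hT₀] using (hSlim i m).add h1
  have hTv : ∀ w : Fin N → ℝ, ∀ m : Fin N, T₀.mulVec w m =
      besselCoeff ν (m : ℕ) * ∑ i : Fin N, (besselCoeff ν (i : ℕ) * w i / e) /
        (ν + 1 + (i : ℕ) + (m : ℕ)) := by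
    intro w m
    rw [Matrix.mulVec, dotProduct, Finset.mul_sum]
    refine Finset.sum_congr rfl fun i _ => ?_
    have : 0 < ν + 1 + (i : ℕ) + (m : ℕ) := by positivity
    simp only [hT₀, Matrix.of_apply]
    field_simp
  have hdet : T₀.det ≠ 0 := by
    intro hd
    obtain ⟨w, hw, hw0⟩ := Matrix.exists_mulVec_eq_zero_iff.2 hd
    refine hw (funext fun i => ?_)
    have h1 := eq_zero_of_cauchy_sum_eq_zero hx
      (c := fun i : Fin N => besselCoeff ν (i : ℕ) * w i / e) fun m => by
        have h2 := congrFun hw0 m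
        rw [hTv, Pi.zero_apply, mul_eq_zero] at h2
        exact h2.resolve_left (hφ m)
    have h3 := congrFun h1 i
    simp only [Pi.zero_apply, div_eq_zero_iff, mul_eq_zero] at h3
    simpa [hφ, he.ne'] using h3
  obtain ⟨u₀, hulim, hu₀⟩ := exists_tendsto_of_mulVec_eq (u := u)
    (v := fun n m => π n m) (v₀ := fun m => besselCoeff ν (m : ℕ)) hTlim hdet
    (tendsto_pi_nhds.2 fun m => hlim m) (by
      filter_upwards [eventually_gt_atTop 0] with n hn
      funext m
      have h1 := hG1 n hn m
      rw [hG2 n hn m] at h1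
      have h2 : (T n).mulVec (u n) m = (∑ i, u n i * S n i m) + ε n m * u n m := by
        simp only [hT, Matrix.mulVec, dotProduct, Matrix.of_apply, add_mul, ite_mul, zero_mul,
          Finset.sum_add_distrib, Finset.sum_ite_eq, Finset.mem_univ, if_true]
        congr 1
        exact Finset.sum_congr rfl fun i _ => mul_comm _ _
      rw [h2]
      linarith)
  rw [tendsto_pi_nhds] at hulim
  have hcauchy : ∀ m : Fin N, ∑ i : Fin N, (besselCoeff ν (i : ℕ) * u₀ i / e) /
      (ν + 1 + (i : ℕ) + (m : ℕ)) = 1 := by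
    intro m
    have h1 := congrFun hu₀ m
    rw [hTv] at h1
    exact (mul_eq_left₀ (hφ m)).1 h1
  have hGlim : ∀ m, Tendsto (fun n => G n m) atTop
      (𝓝 (if m < N then 0 else (-1) ^ N * besselCoeff (ν + 2 * N) (m - N))) := by
    intro m
    have h1 : Tendsto (fun n => π n m - ∑ i, u n i * S n i m) atTop (𝓝 (besselCoeff ν m -
        ∑ i : Fin N, u₀ i * (besselCoeff ν i * besselCoeff ν m / (e * (ν + 1 + (i : ℕ) + m))))) :=
      (hlim m).sub (tendsto_finsetSum _ fun i _ => (hulim i).mul (hSlim i m))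
    have h2 : besselCoeff ν m -
        ∑ i : Fin N, u₀ i * (besselCoeff ν i * besselCoeff ν m / (e * (ν + 1 + (i : ℕ) + m))) =
        besselCoeff ν m * (1 - ∑ i : Fin N, (besselCoeff ν (i : ℕ) * u₀ i / e) /
          (ν + 1 + (i : ℕ) + m)) := by
      rw [mul_sub, mul_one, Finset.mul_sum]
      congr 1
      refine Finset.sum_congr rfl fun i _ => ?_
      have : 0 < ν + 1 + (i : ℕ) + m := by positivity
      field_simp
    rw [h2, one_sub_cauchy_sum hx hcauchy m.cast_nonneg, besselCoeff_mul_prod hν] at h1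
    refine h1.congr' ?_
    filter_upwards [eventually_gt_atTop 0] with n hn
    rw [hG1 n hn m]
  have hγlim : Tendsto γ atTop (𝓝 1) := by
    have h1 : Tendsto (fun n : ℕ => 1 + (n : ℝ)⁻¹ * ∑ i, u n i * π n i) atTop (𝓝 1) := by
      simpa using ((tendsto_inv_atTop_nhds_zero_nat (𝕜 := ℝ)).mul
        (tendsto_finsetSum Finset.univ fun i _ => (hulim i).mul (hlim i))).const_add 1
    have h2 := (h1.inv₀ one_ne_zero).sqrt
    rw [inv_one, Real.sqrt_one] at h2
    refine h2.congr' ?_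
    filter_upwards [eventually_gt_atTop 0] with n hn
    have h3 : ∑ i : Fin N, M i * g n i * h n i = γ n * ((n : ℝ)⁻¹ * ∑ i, u n i * π n i) := by
      rw [Finset.mul_sum, Finset.mul_sum]
      refine Finset.sum_congr rfl fun i _ => ?_
      have h0 : (n : ℝ) ≠ 0 := by exact_mod_cast hn.ne'
      have h4 := (hbp n).ne'
      rw [hMg n hn i]
      simp only [hπ]
      field_simp
    have h4 : γ n ^ 2 * (1 + (n : ℝ)⁻¹ * ∑ i, u n i * π n i) = 1 := by
      linear_combination hgγ n - γ n * h3
    rw [← eq_inv_of_mul_eq_one_left h4, Real.sqrt_sq (hγ n).le]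
  have hgG : ∀ n m, (-1) ^ n * α n / b n ^ m * g n m = γ n * G n m := fun n m => by
    have := (hγ n).ne'
    simp only [hG]
    field_simp
  refine ⟨fun m => ?_, fun R hR => ?_⟩
  · simpa only [hgG, one_mul] using hγlim.mul (hGlim m)
  obtain ⟨K, hK, hbK⟩ := exists_forall_lt_le_mul hbp hb hB he
  obtain ⟨C, hC⟩ := hbd (R * K) (by positivity)
  obtain ⟨C', hC'⟩ := hbd R hR
  set V : ℕ → ℕ → ℝ := fun n i => α n ^ 2 / (n * b n ^ i) *
    ∑ k ∈ Finset.range n, (α k)⁻¹ ^ 2 * b k ^ i * |π k i| with hV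
  have hVlim := fun i : ℕ =>
    tendsto_weighted_average hαp hbp hα hb hA hB i (hpos i) (hlim i).abs
  have hSV : ∀ᶠ n in atTop, ∀ i m, |S n i m| ≤ V n i * (C / R ^ m) := by
    filter_upwards [hbK, eventually_gt_atTop 0] with n hn hn0 i m
    have hn' : (0 : ℝ) < n := by exact_mod_cast hn0
    have h2 := hbp n
    have h1 := hαp n
    simp only [hS, hV]
    rw [abs_mul, abs_of_nonneg (by positivity)]
    have h3 : ∀ k ∈ Finset.range n, |h k i * h k m| ≤
        (α k)⁻¹ ^ 2 * b k ^ i * |π k i| * (b n ^ m * (C / R ^ m)) := by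
      intro k hk
      have h4 := hbp k
      have h5 := hαp k
      have h6 : b k ^ m * |π k m| ≤ b n ^ m * (C / R ^ m) := by
        calc b k ^ m * |π k m| ≤ (K * b n) ^ m * (C / (R * K) ^ m) := by
              refine mul_le_mul ?_ (hC k m) (abs_nonneg _) (by positivity)
              exact pow_le_pow_left₀ h4.le (hn k (Finset.mem_range.1 hk)) m
          _ = _ := by rw [mul_pow, mul_pow]; field_simp
      rw [hhπ, abs_mul, abs_mul (π k i), abs_of_nonneg (by positivity), pow_add]
      calc _ = (α k)⁻¹ ^ 2 * b k ^ i * |π k i| * (b k ^ m * |π k m|) := by ring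
        _ ≤ _ := by gcongr
    have h7 := (Finset.abs_sum_le_sum_abs _ _).trans (Finset.sum_le_sum h3)
    rw [← Finset.sum_mul] at h7
    refine (mul_le_mul_of_nonneg_left h7 (by positivity)).trans_eq ?_
    rw [pow_add]
    field_simp
  have hbound : Tendsto (fun n => γ n * (C' + ∑ i : Fin N, |u n i| * (V n i * C))) atTop
      (𝓝 (1 * (C' + ∑ i : Fin N, |u₀ i| *
        (|besselCoeff ν (i : ℕ)| / (2 * a + e * (i : ℕ) + 1) * C)))) :=
    hγlim.mul ((tendsto_finsetSum _ fun i _ =>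
      ((hulim i).abs).mul ((hVlim i).mul_const C)).const_add C')
  obtain ⟨D, hD⟩ : ∃ D, ∀ᶠ n in atTop, γ n * (C' + ∑ i : Fin N, |u n i| * (V n i * C)) < D :=
    ⟨_, hbound.eventually_lt_const (lt_add_one _)⟩
  refine ⟨D, ?_⟩
  filter_upwards [hSV, hD, eventually_gt_atTop 0] with n hn hn2 hn0 m
  have hRm : 0 < R ^ m := by positivity
  refine le_trans ?_ (div_le_div_of_nonneg_right hn2.le hRm.le)
  rw [hgG, abs_mul, abs_of_pos (hγ n), mul_div_assoc]
  refine mul_le_mul_of_nonneg_left ?_ (hγ n).le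
  rw [hG1 n hn0 m, add_div, Finset.sum_div]
  refine (abs_sub _ _).trans (add_le_add (hC' n m) ?_)
  refine (Finset.abs_sum_le_sum_abs _ _).trans (Finset.sum_le_sum fun i _ => ?_)
  rw [abs_mul, mul_div_assoc, mul_div_assoc]
  exact mul_le_mul_of_nonneg_left (hn i m) (abs_nonneg _)

theorem tsum_ite_lt_shift {f : ℕ → ℂ} {w : ℂ} (N : ℕ) (x : ℂ) (hf : Summable fun m => f m * w ^ m) :
    ∑' m, (if m < N then 0 else x * f (m - N)) * w ^ m = x * w ^ N * ∑' m, f m * w ^ m := by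
  have h1 : ∀ m, (if m + N < N then 0 else x * f (m + N - N)) * w ^ (m + N) =
      x * w ^ N * (f m * w ^ m) := fun m => by
    rw [if_neg (by omega), Nat.add_sub_cancel, pow_add]
    ring
  have h2 : Summable fun m => (if m < N then 0 else x * f (m - N)) * w ^ m := by
    rw [← summable_nat_add_iff N]
    simp only [h1]
    exact hf.mul_left _
  rw [← h2.sum_add_tsum_nat_add N, Finset.sum_eq_zero, zero_add, ← tsum_mul_left]
  · simp only [h1]
  · intro m hm
    rw [if_pos (Finset.mem_range.1 hm), zero_mul]

theorem scaled_aeval_eq_tsum (c s t : ℝ) (f : ℝ[X]) (z : ℂ) :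
    (s : ℂ) * aeval ((c : ℂ) + z ^ 2 / (t : ℂ)) f =
      ∑' m, ((s / t ^ m * taylorCoeff c m f : ℝ) : ℂ) * (z ^ 2) ^ m := by
  rw [aeval_eq_tsum_taylorCoeff, ← tsum_mul_left]
  refine tsum_congr fun m => ?_
  push_cast
  rw [div_pow]
  ring

/-- **Theorem 5 (Mehler–Heine asymptotics).** If `c = inf (supp μ)`, all the masses are
positive, and `(-1)^n (a_n^{1/2}/b_n^j) p_n^{[2j]}(c + z²/b_n) → φ_{ν+2j}(z)` uniformly on
compact subsets of `ℂ` for `j = 0,…,r+1`, with `a_n^{-1/2} ≅ A n^a`, `b_n ≅ B n^b` and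
`2a+1 = b(ν+1)`, then `(-1)^n a_n^{1/2} q_n(c + z²/b_n) → (-1)^{r+1} z^{2r+2} φ_{ν+2r+2}(z)`
uniformly on compact subsets of `ℂ`. -/
theorem mehler_heine_sobolev
    (μ : Measure ℝ) [IsFiniteMeasure μ]
    (hsupp : (measSupport μ).Infinite)
    (hint : ∀ p : Polynomial ℝ, Integrable (fun x => p.eval x) μ)
    (c : ℝ) (hc : c = sInf (measSupport μ))
    (r : ℕ) (M : ℕ → ℝ) (hM : ∀ i ≤ r, 0 < M i)
    (P : ℕ → ℕ → Polynomial ℝ)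
    (hP : ∀ j ≤ r + 1, IsOPS (muMod μ c (2 * j)) (P j))
    (q : ℕ → Polynomial ℝ) (hq : IsSobOPS μ c r M q)
    (a b : ℕ → ℝ) (ha : ∀ n, 0 < a n) (hb : ∀ n, 0 < b n)
    (A B bexp : ℝ) (aexp : ℝ) (hA : 0 < A) (hB : 0 < B) (hbexp : 0 < bexp)
    (ν : ℝ) (hν : -1 < ν)
    (haA : Filter.Tendsto (fun n : ℕ => (a n) ^ (-(1 : ℝ) / 2) / (A * (n : ℝ) ^ aexp))
      Filter.atTop (nhds 1))
    (hbB : Filter.Tendsto (fun n : ℕ => b n / (B * (n : ℝ) ^ bexp)) Filter.atTop (nhds 1))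
    (hlink : 2 * aexp + 1 = bexp * (ν + 1))
    (hMH : ∀ j ≤ r + 1, ∀ K : Set ℂ, IsCompact K →
      TendstoUniformlyOn
        (fun (n : ℕ) (z : ℂ) =>
          (((-1 : ℝ) ^ n * ((a n) ^ ((1 : ℝ) / 2) / (b n) ^ j) : ℝ) : ℂ) *
            Polynomial.aeval ((c : ℂ) + z ^ 2 / (b n : ℂ)) (P j n))
        (fun z => phi (ν + 2 * j) z) Filter.atTop K) :
    ∀ K : Set ℂ, IsCompact K →
      TendstoUniformlyOn
        (fun (n : ℕ) (z : ℂ) =>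
          (((-1 : ℝ) ^ n * (a n) ^ ((1 : ℝ) / 2) : ℝ) : ℂ) *
            Polynomial.aeval ((c : ℂ) + z ^ 2 / (b n : ℂ)) (q n))
        (fun z => (-1 : ℂ) ^ (r + 1) * z ^ (2 * r + 2) * phi (ν + 2 * (r + 1)) z)
        Filter.atTop K := by
  have hp := hP 0 (Nat.zero_le _)
  have hmod : muMod μ c (2 * 0) = μ := by simp [muMod]
  rw [hmod] at hp
  obtain ⟨hpd, hpl, hpo⟩ := hp
  obtain ⟨hqd, hql, hqo⟩ := hq
  let Λ : ℝ[X] →ₗ[ℝ] ℝ :=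
    { toFun := fun f => ∫ x, f.eval x ∂μ
      map_add' := fun f g => by
        simp only [eval_add]
        exact integral_add (hint f) (hint g)
      map_smul' := fun s f => by
        simp only [eval_smul, smul_eq_mul, RingHom.id_apply, integral_const_mul] }
  set M' : Fin (r + 1) → ℝ := fun i => M i * ((i : ℕ).factorial : ℝ) ^ 2 with hM'
  have hM'pos : ∀ i, 0 < M' i := fun i => by
    have := hM i (Nat.le_of_lt_succ i.2)
    positivity
  have key := sobolev_connection (N := r + 1) (Λ := Λ) (ℓ := fun i => taylorCoeff c i) (M := M')
    (p := P 0) (q := q) hpd hpl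
    (fun n m => by simpa [Λ, eval_mul] using hpo n m) hqd hql
    (fun n m => by
      rw [← hqo n m, sobInner, Finset.sum_range]
      congr 1
      · simp [Λ]
      · refine Finset.sum_congr rfl fun i _ => ?_
        rw [eval_iterate_derivative, eval_iterate_derivative]
        simp only [hM']
        ring)
  choose γ hγ hgq hgγ using key
  set α : ℕ → ℝ := fun n => a n ^ ((1 : ℝ) / 2) with hα
  have hαpos : ∀ n, 0 < α n := fun n => Real.rpow_pos_of_pos (ha n) _
  have hαA : Tendsto (fun n : ℕ => (α n)⁻¹ / (A * (n : ℝ) ^ aexp)) atTop (𝓝 1) := by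
    refine haA.congr fun n => ?_
    rw [neg_div, Real.rpow_neg (ha n).le]
  have hscale := fun (f : ℝ[X]) (n : ℕ) (z : ℂ) =>
    scaled_aeval_eq_tsum c ((-1) ^ n * α n) (b n) f z
  have hsum := fun (n : ℕ) (f : ℝ[X]) (z : ℂ) =>
    summable_taylorCoeff c f fun m => (((-1) ^ n * α n / b n ^ m : ℝ) : ℂ) * z ^ m
  obtain ⟨hlim, hbd⟩ := coeff_of_tendstoUniformlyOn_sq
    (c := fun n m => (((-1) ^ n * α n / b n ^ m * taylorCoeff c m (P 0 n) : ℝ) : ℂ))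
    (f := fun m => (besselCoeff ν m : ℂ))
    (fun n z => by
      refine (hsum n (P 0 n) z).congr fun m => ?_
      push_cast
      ring)
    (summable_besselCoeff hν)
    (fun K hK => by
      have h1 := hMH 0 (Nat.zero_le _) K hK
      simp only [pow_zero, div_one, Nat.cast_zero, mul_zero, add_zero] at h1
      refine (h1.congr ?_).congr_right fun z _ => phi_eq_tsum ν z
      exact Eventually.of_forall fun n z _ => hscale (P 0 n) n z)
  have hmain := tendsto_sobolev_coeff (N := r + 1) (M := M') (γ := γ) (α := α) (b := b)
    (h := fun n m => taylorCoeff c m (P 0 n)) (g := fun n m => taylorCoeff c m (q n))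
    hM'pos hγ
    (fun n m => by
      have h1 := congrArg (taylorCoeff c m) (hgq n)
      simpa only [map_sub, map_smul, map_sum, smul_eq_mul] using h1)
    hgγ hαpos hb hαA hbB hA hB hbexp hν hlink
    (fun m => (Complex.continuous_re.tendsto _).comp (hlim m))
    (fun R hR => by
      obtain ⟨C, hC⟩ := hbd R hR
      exact ⟨C, fun n m => by simpa only [Complex.norm_real, Real.norm_eq_abs] using hC n m⟩)
  intro K hK
  obtain ⟨ρ, hρ⟩ := (hK.image (continuous_pow 2)).isBounded.subset_closedBall (0 : ℂ)
  have hfin := tendstoUniformlyOn_tsum_of_tendsto_coeff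
    (c := fun n m => (((-1) ^ n * α n / b n ^ m * taylorCoeff c m (q n) : ℝ) : ℂ))
    (f := fun m => if m < r + 1 then 0 else
      (-1) ^ (r + 1) * (besselCoeff (ν + 2 * (r + 1 : ℕ)) (m - (r + 1)) : ℂ))
    (fun m => by
      convert (Complex.continuous_ofReal.tendsto _).comp (hmain.1 m) using 2
      · rfl
      · split_ifs <;> push_cast <;> rfl)
    (fun R hR => by
      obtain ⟨C, hC⟩ := hmain.2 R hR
      refine ⟨C, hC.mono fun n hn m => ?_⟩
      rw [Complex.norm_real]
      exact hn m) ρ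
  refine (((hfin.comp fun z : ℂ => z ^ 2).mono fun z hz => hρ ⟨z, hz, rfl⟩).congr ?_).congr_right
    fun z _ => ?_
  · exact Eventually.of_forall fun n z _ => (hscale (q n) n z).symm
  · have h2 : -1 < ν + 2 * ((r + 1 : ℕ) : ℝ) := by
      have : (0 : ℝ) ≤ (r + 1 : ℕ) := Nat.cast_nonneg _
      linarith
    have h3 := tsum_ite_lt_shift (r + 1) ((-1) ^ (r + 1)) (summable_besselCoeff h2 (z ^ 2))
    simp only [Function.comp_apply]
    rw [h3, ← phi_eq_tsum]
    push_cast
    ring
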